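/- Let ω ∈ (0,1) be irrational and (C,τ)-Diophantine with 0 < C ≤ 1 and τ ≥ 1. Then for every Δ > 0, as inequalities in [0,∞]: 𝔅rj₁(Δ) ≤ C^{−1} 𝔇ph₁(Δ) and 𝔅rj₂(Δ) ≤ C^{−1} log(C^{−1}) 𝔇ph₁(Δ) + C^{−1} (τ−1) 𝔇ph₂(Δ). -/

import Mathlib

open Real
open scoped ENNReal

noncomputable section

/-- The Gauss-map iterates of `ω`. -/
def cfX (ω : ℝ) : ℕ → ℝ
  | 0 => ω
  | n + 1 => Int.fract (cfX ω n)⁻¹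

/-- The partial quotients of `ω`: for `n ≥ 1`, `cfA ω n = ⌊1 / x_{n-1}⌋`. -/
def cfA (ω : ℝ) : ℕ → ℕ
  | 0 => 0
  | n + 1 => (⌊(cfX ω n)⁻¹⌋).toNat

/-- Denominators of the convergents of `ω`. -/
def cfQ (ω : ℝ) : ℕ → ℕ
  | 0 => 1
  | 1 => cfA ω 1
  | n + 2 => cfA ω (n + 2) * cfQ ω (n + 1) + cfQ ω n

/-- First Brjuno-like function `𝔅rj₁(Δ) = Σ_{n=1}^∞ e^{-q_n Δ} q_{n+1}`, valued in `[0,∞]`. -/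
def Brj1 (ω Δ : ℝ) : ℝ≥0∞ :=
  ∑' n : ℕ, ENNReal.ofReal (Real.exp (-(cfQ ω (n + 1) : ℝ) * Δ) * (cfQ ω (n + 2) : ℝ))

/-- Second Brjuno-like function `𝔅rj₂(Δ) = Σ_{n=1}^∞ e^{-q_n Δ} q_{n+1} log a_{n+1}`. -/
def Brj2 (ω Δ : ℝ) : ℝ≥0∞ :=
  ∑' n : ℕ, ENNReal.ofReal
    (Real.exp (-(cfQ ω (n + 1) : ℝ) * Δ) * (cfQ ω (n + 2) : ℝ) * Real.log (cfA ω (n + 2) : ℝ))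

/-- `𝔇ph₁(Δ) = Σ_{n=1}^∞ e^{-q_n Δ} q_n^τ`, valued in `[0,∞]`. -/
def Dph1 (ω τ Δ : ℝ) : ℝ≥0∞ :=
  ∑' n : ℕ, ENNReal.ofReal (Real.exp (-(cfQ ω (n + 1) : ℝ) * Δ) * (cfQ ω (n + 1) : ℝ) ^ τ)

/-- `𝔇ph₂(Δ) = Σ_{n=1}^∞ e^{-q_n Δ} q_n^τ log q_n`, valued in `[0,∞]`. -/
def Dph2 (ω τ Δ : ℝ) : ℝ≥0∞ :=
  ∑' n : ℕ, ENNReal.ofReal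
    (Real.exp (-(cfQ ω (n + 1) : ℝ) * Δ) * (cfQ ω (n + 1) : ℝ) ^ τ *
      Real.log (cfQ ω (n + 1) : ℝ))

/-- `ω` is `(C,τ)`-Diophantine: `|qω - p| ≥ C/|q|^τ` for all integers `p`, `q ≠ 0`. -/
def IsDiophantine (C τ ω : ℝ) : Prop :=
  ∀ p q : ℤ, q ≠ 0 → C / |(q : ℝ)| ^ τ ≤ |(q : ℝ) * ω - (p : ℝ)|

end

theorem cfX_irrational {ω : ℝ} (hirr : Irrational ω) (n : ℕ) : Irrational (cfX ω n) := by
  induction n with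
  | zero => exact hirr
  | succ n ih =>
    simp only [cfX, Int.fract]
    exact ih.inv.sub_intCast _

theorem cfX_mem_Ioo {ω : ℝ} (hirr : Irrational ω) (hω0 : 0 < ω) (hω1 : ω < 1) (n : ℕ) :
    cfX ω n ∈ Set.Ioo (0 : ℝ) 1 := by
  cases n with
  | zero => exact ⟨hω0, hω1⟩
  | succ n =>
    exact ⟨lt_of_le_of_ne (Int.fract_nonneg _) (cfX_irrational hirr (n + 1)).ne_zero.symm,
      Int.fract_lt_one _⟩

theorem one_le_cfA_succ {ω : ℝ} (hirr : Irrational ω) (hω0 : 0 < ω) (hω1 : ω < 1) (n : ℕ) :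
    1 ≤ cfA ω (n + 1) := by
  obtain ⟨h0, h1⟩ := cfX_mem_Ioo hirr hω0 hω1 n
  have h : (1 : ℤ) ≤ ⌊(cfX ω n)⁻¹⌋ := by
    rw [Int.le_floor, Int.cast_one]
    exact (one_le_inv₀ h0).2 h1.le
  simp only [cfA]
  omega

theorem cfX_succ {ω : ℝ} (hirr : Irrational ω) (hω0 : 0 < ω) (hω1 : ω < 1) (n : ℕ) :
    cfX ω (n + 1) = (cfX ω n)⁻¹ - cfA ω (n + 1) := by
  have h : (0 : ℤ) ≤ ⌊(cfX ω n)⁻¹⌋ :=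
    Int.floor_nonneg.2 (inv_nonneg.2 (cfX_mem_Ioo hirr hω0 hω1 n).1.le)
  have h2 : ((cfA ω (n + 1) : ℤ) : ℝ) = ⌊(cfX ω n)⁻¹⌋ := by
    simp only [cfA, Int.toNat_of_nonneg h]
  rw [Int.cast_natCast] at h2
  simp only [cfX, Int.fract, h2]

theorem cfQ_pos {ω : ℝ} (hirr : Irrational ω) (hω0 : 0 < ω) (hω1 : ω < 1) :
    ∀ n : ℕ, 0 < cfQ ω n
  | 0 => Nat.one_pos
  | 1 => one_le_cfA_succ hirr hω0 hω1 0
  | n + 2 => by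
    simp only [cfQ]
    exact Nat.add_pos_right _ (cfQ_pos hirr hω0 hω1 n)

/-- The products `x_0 ⋯ x_n` of Gauss-map iterates, equal to `|q_n ω - p_n|`. -/
noncomputable def cfBeta (ω : ℝ) (n : ℕ) : ℝ := ∏ i ∈ Finset.range (n + 1), cfX ω i

theorem cfBeta_succ (ω : ℝ) (n : ℕ) : cfBeta ω (n + 1) = cfBeta ω n * cfX ω (n + 1) :=
  Finset.prod_range_succ _ _

theorem cfBeta_pos {ω : ℝ} (hirr : Irrational ω) (hω0 : 0 < ω) (hω1 : ω < 1) (n : ℕ) :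
    0 < cfBeta ω n :=
  Finset.prod_pos fun i _ => (cfX_mem_Ioo hirr hω0 hω1 i).1

theorem cfBeta_one {ω : ℝ} (hirr : Irrational ω) (hω0 : 0 < ω) (hω1 : ω < 1) :
    cfBeta ω 1 = 1 - cfA ω 1 * ω := by
  have h : cfBeta ω 1 = ω * cfX ω 1 := by simp [cfBeta, Finset.prod_range_succ, cfX]
  rw [h, cfX_succ hirr hω0 hω1 0, cfX]
  field_simp

theorem cfBeta_add_two {ω : ℝ} (hirr : Irrational ω) (hω0 : 0 < ω) (hω1 : ω < 1) (n : ℕ) :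
    cfBeta ω (n + 2) = cfBeta ω n - cfA ω (n + 2) * cfBeta ω (n + 1) := by
  have hx := (cfX_mem_Ioo hirr hω0 hω1 (n + 1)).1.ne'
  rw [cfBeta_succ ω (n + 1), cfX_succ hirr hω0 hω1 (n + 1), cfBeta_succ ω n]
  field_simp

theorem cfQ_mul_cfBeta_add {ω : ℝ} (hirr : Irrational ω) (hω0 : 0 < ω) (hω1 : ω < 1) (n : ℕ) :
    (cfQ ω (n + 1) : ℝ) * cfBeta ω n + cfQ ω n * cfBeta ω (n + 1) = 1 := by
  induction n with
  | zero =>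
    rw [cfBeta_one hirr hω0 hω1]
    simp [cfQ, cfBeta, cfX]
  | succ n ih =>
    rw [cfBeta_add_two hirr hω0 hω1, cfQ]
    push_cast
    linear_combination ih

theorem exists_cfQ_mul_sub_eq {ω : ℝ} (hirr : Irrational ω) (hω0 : 0 < ω) (hω1 : ω < 1) :
    ∀ n : ℕ, ∃ p : ℤ, (cfQ ω n : ℝ) * ω - p = (-1) ^ n * cfBeta ω n
  | 0 => ⟨0, by simp [cfQ, cfBeta, cfX]⟩
  | 1 => ⟨1, by rw [cfBeta_one hirr hω0 hω1]; simp [cfQ]⟩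
  | n + 2 => by
    obtain ⟨p, hp⟩ := exists_cfQ_mul_sub_eq hirr hω0 hω1 n
    obtain ⟨r, hr⟩ := exists_cfQ_mul_sub_eq hirr hω0 hω1 (n + 1)
    refine ⟨cfA ω (n + 2) * r + p, ?_⟩
    rw [cfBeta_add_two hirr hω0 hω1, cfQ]
    push_cast
    linear_combination hp + (cfA ω (n + 2) : ℝ) * hr

/-- A Diophantine condition bounds the growth of the denominators of the convergents. -/
theorem IsDiophantine.cfQ_succ_le {C τ ω : ℝ} (hdio : IsDiophantine C τ ω) (hirr : Irrational ω)
    (hω0 : 0 < ω) (hω1 : ω < 1) (hC0 : 0 < C) (n : ℕ) :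
    (cfQ ω (n + 1) : ℝ) ≤ C⁻¹ * (cfQ ω n : ℝ) ^ τ := by
  obtain ⟨p, hp⟩ := exists_cfQ_mul_sub_eq hirr hω0 hω1 n
  have hq : (0 : ℝ) < cfQ ω n := Nat.cast_pos.2 (cfQ_pos hirr hω0 hω1 n)
  have hβ := cfBeta_pos hirr hω0 hω1 n
  have hdist := hdio p (cfQ ω n) (by exact_mod_cast (cfQ_pos hirr hω0 hω1 n).ne')
  rw [Int.cast_natCast, hp, abs_mul, abs_pow, abs_neg, abs_one, one_pow, one_mul, abs_of_pos hβ,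
    abs_of_pos hq, div_le_iff₀ (Real.rpow_pos_of_pos hq τ)] at hdist
  have hle : (cfQ ω (n + 1) : ℝ) * cfBeta ω n ≤ 1 := by
    have h := mul_pos hq (cfBeta_pos hirr hω0 hω1 (n + 1))
    linarith [cfQ_mul_cfBeta_add hirr hω0 hω1 n]
  rw [le_inv_mul_iff₀ hC0]
  calc C * (cfQ ω (n + 1) : ℝ)
      ≤ cfBeta ω n * (cfQ ω n : ℝ) ^ τ * cfQ ω (n + 1) := by gcongr
    _ = (cfQ ω (n + 1) : ℝ) * cfBeta ω n * (cfQ ω n : ℝ) ^ τ := by ring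
    _ ≤ (cfQ ω n : ℝ) ^ τ := mul_le_of_le_one_left (Real.rpow_nonneg hq.le τ) hle

theorem IsDiophantine.log_cfA_le {C τ ω : ℝ} (hdio : IsDiophantine C τ ω) (hirr : Irrational ω)
    (hω0 : 0 < ω) (hω1 : ω < 1) (hC0 : 0 < C) (n : ℕ) :
    Real.log (cfA ω (n + 2)) ≤ Real.log C⁻¹ + (τ - 1) * Real.log (cfQ ω (n + 1)) := by
  have hq : (0 : ℝ) < cfQ ω (n + 1) := Nat.cast_pos.2 (cfQ_pos hirr hω0 hω1 _)
  have ha : (0 : ℝ) < cfA ω (n + 2) := Nat.cast_pos.2 (one_le_cfA_succ hirr hω0 hω1 _)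
  have hle : (cfA ω (n + 2) : ℝ) * cfQ ω (n + 1) ≤ C⁻¹ * (cfQ ω (n + 1) : ℝ) ^ τ := by
    refine le_trans ?_ (hdio.cfQ_succ_le hirr hω0 hω1 hC0 (n + 1))
    rw [cfQ]
    push_cast
    exact le_add_of_nonneg_right (Nat.cast_nonneg _)
  have hlog := Real.log_le_log (mul_pos ha hq) hle
  rw [Real.log_mul ha.ne' hq.ne', Real.log_mul (inv_pos.2 hC0).ne'
    (Real.rpow_pos_of_pos hq τ).ne', Real.log_rpow hq] at hlog
  linarith

/-- for a `(C,τ)`-Diophantine irrational `ω ∈ (0,1)` with `0 < C ≤ 1`, `τ ≥ 1`,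
and every `Δ > 0`, as inequalities in `[0,∞]`:
`𝔅rj₁(Δ) ≤ C⁻¹ 𝔇ph₁(Δ)` and `𝔅rj₂(Δ) ≤ C⁻¹ log(C⁻¹) 𝔇ph₁(Δ) + C⁻¹ (τ-1) 𝔇ph₂(Δ)`. -/
theorem brj_le_dph_of_diophantine (ω : ℝ) (hirr : Irrational ω) (hω0 : 0 < ω) (hω1 : ω < 1)
    (C τ : ℝ) (hC0 : 0 < C) (hC1 : C ≤ 1) (hτ : 1 ≤ τ) (hdio : IsDiophantine C τ ω)
    (Δ : ℝ) (hΔ : 0 < Δ) :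
    Brj1 ω Δ ≤ ENNReal.ofReal C⁻¹ * Dph1 ω τ Δ ∧
    Brj2 ω Δ ≤ ENNReal.ofReal (C⁻¹ * Real.log C⁻¹) * Dph1 ω τ Δ +
      ENNReal.ofReal (C⁻¹ * (τ - 1)) * Dph2 ω τ Δ := by
  have hlogC : 0 ≤ Real.log C⁻¹ := Real.log_nonneg ((one_le_inv₀ hC0).2 hC1)
  have hCinv : 0 < C⁻¹ := inv_pos.2 hC0
  have hbound : ∀ n, Real.exp (-(cfQ ω (n + 1) : ℝ) * Δ) * (cfQ ω (n + 2) : ℝ) ≤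
      C⁻¹ * (Real.exp (-(cfQ ω (n + 1) : ℝ) * Δ) * (cfQ ω (n + 1) : ℝ) ^ τ) := fun n => by
    rw [mul_left_comm]
    exact mul_le_mul_of_nonneg_left (hdio.cfQ_succ_le hirr hω0 hω1 hC0 (n + 1))
      (Real.exp_pos _).le
  constructor
  · rw [Brj1, Dph1, ← ENNReal.tsum_mul_left]
    refine ENNReal.tsum_le_tsum fun n => ?_
    rw [← ENNReal.ofReal_mul hCinv.le]
    exact ENNReal.ofReal_le_ofReal (hbound n)
  · rw [Brj2, Dph1, Dph2, ← ENNReal.tsum_mul_left, ← ENNReal.tsum_mul_left, ← ENNReal.tsum_add]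
    refine ENNReal.tsum_le_tsum fun n => ?_
    have hlogQ : 0 ≤ Real.log (cfQ ω (n + 1) : ℝ) := Real.log_natCast_nonneg _
    have hτ' : 0 ≤ τ - 1 := sub_nonneg.2 hτ
    rw [← ENNReal.ofReal_mul (by positivity), ← ENNReal.ofReal_mul (by positivity),
      ← ENNReal.ofReal_add (by positivity) (by positivity)]
    refine ENNReal.ofReal_le_ofReal ?_
    refine (mul_le_mul (hbound n) (hdio.log_cfA_le hirr hω0 hω1 hC0 n)
      (Real.log_natCast_nonneg _) (by positivity)).trans_eq ?_
    ring
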